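/- arXiv:1912.07341 — 5 statements merged into one kernel-verified Lean document; each statement's English description precedes it below -/
import Mathlib

section
/- (Passivity property of the DC grid, Proposition 1(a).) Let n, m be positive integers and let L_s, R_s, C, I_l ∈ ℝ^{n×n} and L, R ∈ ℝ^{m×m} be diagonal matrices with strictly positive diagonal entries, and B ∈ ℝ^{n×m}. Suppose I_s, V, u_s, u_l : ℝ → ℝⁿ and I : ℝ → ℝᵐ are differentiable functions satisfying, for all t, the grid dynamics L_s İ_s(t) = −R_s I_s(t) − V(t) + u_s(t), L İ(t) = −R I(t) − Bᵀ V(t), C V̇(t) = I_s(t) + B I(t) − I_l u_l(t), and suppose u_s, u_l are differentiable with derivatives u_{sd}, u_{ld}. Define the storage function S(t) := ½ (İ_s(t)ᵀ L_s İ_s(t) + İ(t)ᵀ L İ(t) + V̇(t)ᵀ C V̇(t)). Then S is differentiable and, for all t, S'(t) = −İ_s(t)ᵀ R_s İ_s(t) − İ(t)ᵀ R İ(t) + u_{sd}(t)ᵀ İ_s(t) − u_{ld}(t)ᵀ I_l V̇(t); in particular S'(t) ≤ u_{sd}(t)ᵀ İ_s(t) − u_{ld}(t)ᵀ I_l V̇(t),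 i.e., the grid with input derivative (u_{sd}, u_{ld}) and output (İ_s, −I_l V̇) is passive. -/
open Matrix

/-- Multiplying by a constant matrix commutes with differentiation. -/
theorem hasDerivAt_const_mulVec {ι κ : Type*} [Fintype ι] [Fintype κ] (A : Matrix ι κ ℝ)
    {f : ℝ → κ → ℝ} {f' : κ → ℝ} {t : ℝ} (hf : HasDerivAt f f' t) :
    HasDerivAt (fun s => A *ᵥ f s) (A *ᵥ f') t := by
  rw [hasDerivAt_pi] at hf ⊢
  intro i
  simp only [mulVec, dotProduct]
  exact HasDerivAt.fun_sum fun j _ => (hf j).const_mul (A i j)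

/-- The derivative of a diagonal quadratic form `xᵀ D x` when `D x` is differentiable. -/
theorem hasDerivAt_dotProduct_diagonal_mulVec {ι : Type*} [Fintype ι] [DecidableEq ι]
    {d : ι → ℝ} (hd : ∀ i, 0 < d i) {x g : ℝ → ι → ℝ} (hx : ∀ s, diagonal d *ᵥ x s = g s)
    {g' : ι → ℝ} {t : ℝ} (hg : HasDerivAt g g' t) :
    HasDerivAt (fun s => x s ⬝ᵥ diagonal d *ᵥ x s) (2 * (x t ⬝ᵥ g')) t := by
  have hcoord : ∀ s i, x s i = g s i / d i := fun s i => by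
    rw [← hx s, mulVec_diagonal, mul_div_cancel_left₀ _ (hd i).ne']
  simp only [hx, dotProduct, hcoord, Finset.mul_sum]
  rw [hasDerivAt_pi] at hg
  refine HasDerivAt.fun_sum fun i _ => ?_
  exact (((hg i).div_const (d i)).mul (hg i)).congr_deriv (by ring)

theorem dotProduct_diagonal_mulVec_self_nonneg {ι : Type*} [Fintype ι] [DecidableEq ι]
    {d : ι → ℝ} (hd : ∀ i, 0 ≤ d i) (x : ι → ℝ) : 0 ≤ x ⬝ᵥ diagonal d *ᵥ x := by
  simp only [dotProduct, mulVec_diagonal]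
  refine Finset.sum_nonneg fun i _ => ?_
  rw [mul_left_comm]
  exact mul_nonneg (hd i) (mul_self_nonneg _)

/-- Passivity property of the DC grid (Proposition 1(a)): along solutions of the grid
dynamics, the storage function `S = ½ ẋᵀ M ẋ` satisfies
`S' = −İ_sᵀ R_s İ_s − İᵀ R İ + u_{sd}ᵀ İ_s − u_{ld}ᵀ I_l V̇ ≤ u_{sd}ᵀ İ_s − u_{ld}ᵀ I_l V̇`. -/
theorem stmt_2 (n m : ℕ) (hn : 0 < n) (hm : 0 < m)
    (ls rs c il : Fin n → ℝ)
    (hls : ∀ i, 0 < ls i) (hrs : ∀ i, 0 < rs i) (hc : ∀ i, 0 < c i) (hil : ∀ i, 0 < il i)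
    (l r : Fin m → ℝ) (hl : ∀ k, 0 < l k) (hr : ∀ k, 0 < r k)
    (B : Matrix (Fin n) (Fin m) ℝ)
    (Is V us ul Is' V' usd uld : ℝ → Fin n → ℝ) (I I' : ℝ → Fin m → ℝ)
    (hIs : ∀ t, HasDerivAt Is (Is' t) t)
    (hI : ∀ t, HasDerivAt I (I' t) t)
    (hV : ∀ t, HasDerivAt V (V' t) t)
    (hus : ∀ t, HasDerivAt us (usd t) t)
    (hul : ∀ t, HasDerivAt ul (uld t) t)
    (hdyn1 : ∀ t, (Matrix.diagonal ls).mulVec (Is' t) =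
      -((Matrix.diagonal rs).mulVec (Is t)) - V t + us t)
    (hdyn2 : ∀ t, (Matrix.diagonal l).mulVec (I' t) =
      -((Matrix.diagonal r).mulVec (I t)) - Bᵀ.mulVec (V t))
    (hdyn3 : ∀ t, (Matrix.diagonal c).mulVec (V' t) =
      Is t + B.mulVec (I t) - (Matrix.diagonal il).mulVec (ul t))
    (S : ℝ → ℝ)
    (hS : S = fun t => (1/2) * (Is' t ⬝ᵥ (Matrix.diagonal ls).mulVec (Is' t)
          + I' t ⬝ᵥ (Matrix.diagonal l).mulVec (I' t)
          + V' t ⬝ᵥ (Matrix.diagonal c).mulVec (V' t))) :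
    ∀ t, HasDerivAt S
        (-(Is' t ⬝ᵥ (Matrix.diagonal rs).mulVec (Is' t))
          - I' t ⬝ᵥ (Matrix.diagonal r).mulVec (I' t)
          + usd t ⬝ᵥ Is' t - uld t ⬝ᵥ (Matrix.diagonal il).mulVec (V' t)) t
      ∧ (-(Is' t ⬝ᵥ (Matrix.diagonal rs).mulVec (Is' t))
          - I' t ⬝ᵥ (Matrix.diagonal r).mulVec (I' t)
          + usd t ⬝ᵥ Is' t - uld t ⬝ᵥ (Matrix.diagonal il).mulVec (V' t))
        ≤ usd t ⬝ᵥ Is' t - uld t ⬝ᵥ (Matrix.diagonal il).mulVec (V' t) := by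
  intro t
  have hsource := hasDerivAt_dotProduct_diagonal_mulVec hls hdyn1
    (((hasDerivAt_const_mulVec (diagonal rs) (hIs t)).neg.sub (hV t)).add (hus t))
  have hline := hasDerivAt_dotProduct_diagonal_mulVec hl hdyn2
    ((hasDerivAt_const_mulVec (diagonal r) (hI t)).neg.sub (hasDerivAt_const_mulVec Bᵀ (hV t)))
  have hload := hasDerivAt_dotProduct_diagonal_mulVec hc hdyn3
    (((hIs t).add (hasDerivAt_const_mulVec B (hI t))).sub
      (hasDerivAt_const_mulVec (diagonal il) (hul t)))
  have htranspose : V' t ⬝ᵥ B *ᵥ I' t = I' t ⬝ᵥ Bᵀ *ᵥ V' t := by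
    rw [dotProduct_mulVec, ← mulVec_transpose, dotProduct_comm]
  have hsymm : V' t ⬝ᵥ diagonal il *ᵥ uld t = uld t ⬝ᵥ diagonal il *ᵥ V' t := by
    rw [dotProduct_mulVec, ← mulVec_transpose, diagonal_transpose, dotProduct_comm]
  constructor
  · rw [hS]
    refine (((hsource.add hline).add hload).const_mul (1 / 2)).congr_deriv ?_
    simp only [dotProduct_add, dotProduct_sub, dotProduct_neg, htranspose, hsymm,
      dotProduct_comm (V' t) (Is' t), dotProduct_comm (usd t) (Is' t)]
    ring
  · linarith [dotProduct_diagonal_mulVec_self_nonneg (fun i => (hrs i).le) (Is' t),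
      dotProduct_diagonal_mulVec_self_nonneg (fun k => (hr k).le) (I' t)]
end

section
/- (Optimal psycho-social welfare, Lemma 1.) Let n be a positive integer and let π_{c1},…,π_{cn}, π_{u1},…,π_{un}, I_{l1},…,I_{ln} be strictly positive reals. Define λ^{opt} := (Σ_{i=1}^n I_{li}) / (Σ_{i=1}^n (π_{ci} + π_{ui})), and define Ī_{si} := π_{ci} λ^{opt} and ū_{li} := 1 − λ^{opt} π_{ui} / I_{li} for each i. Then: (i) Σ_{i=1}^n Ī_{si} = Σ_{i=1}^n I_{li} ū_{li}; and (ii) for every (I_s, u_l) ∈ ℝⁿ × ℝⁿ with Σ_{i=1}^n I_{si} = Σ_{i=1}^n I_{li} u_{li}, one has Σ_{i=1}^n I_{si}²/(2π_{ci}) + Σ_{i=1}^n I_{li}²(1 − u_{li})²/(2π_{ui}) ≥ Σ_{i=1}^n Ī_{si}²/(2π_{ci}) + Σ_{i=1}^n I_{li}²(1 − ū_{li})²/(2π_{ui}), with equality if and only if (I_s, u_l) = (Ī_s, ū_l). -/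
/-- Expansion of a quadratic generation cost around the point of marginal cost `l`. -/
lemma sq_div_two_mul_eq_add {p l x y : ℝ} (hp : 0 < p) (hy : y = p * l) :
    x ^ 2 / (2 * p) = y ^ 2 / (2 * p) + (x - y) ^ 2 / (2 * p) + l * (x - y) := by
  subst hy
  field_simp
  ring

/-- Expansion of a quadratic disutility around the point of marginal utility `l * I`. -/
lemma sq_mul_one_sub_sq_div_eq_add {p l I u v : ℝ} (hp : 0 < p) (hI : 0 < I)
    (hv : v = 1 - l * p / I) :
    I ^ 2 * (1 - u) ^ 2 / (2 * p) =
      I ^ 2 * (1 - v) ^ 2 / (2 * p) + I ^ 2 * (u - v) ^ 2 / (2 * p) - l * (I * u - I * v) := by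
  subst hv
  field_simp
  ring

/-- A sum over a finite type of weighted squares with positive weights vanishes only when every
difference does. -/
lemma sum_weighted_sq_sub_eq_zero_iff {ι : Type*} [Fintype ι] {w x y : ι → ℝ}
    (hw : ∀ i, 0 < w i) : ∑ i, w i * (x i - y i) ^ 2 = 0 ↔ x = y := by
  rw [Finset.sum_eq_zero_iff_of_nonneg
    fun i _ => mul_nonneg (hw i).le (sq_nonneg _), funext_iff]
  simp [(hw _).ne', sub_eq_zero]

/-- Optimal psycho-social welfare (Lemma 1): the point
`Ī_{si} = π_{ci} λ^{opt}`, `ū_{li} = 1 − λ^{opt} π_{ui}/I_{li}` with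
`λ^{opt} = (Σ I_{li})/(Σ (π_{ci}+π_{ui}))` satisfies the supply–demand constraint and is
the unique minimizer of total cost minus utility among all points satisfying it. -/
theorem stmt_4 (n : ℕ) (hn : 0 < n)
    (pc pu Il : Fin n → ℝ)
    (hpc : ∀ i, 0 < pc i) (hpu : ∀ i, 0 < pu i) (hIl : ∀ i, 0 < Il i)
    (lamOpt : ℝ) (hlam : lamOpt = (∑ i, Il i) / (∑ i, (pc i + pu i)))
    (Isb ulb : Fin n → ℝ)
    (hIsb : ∀ i, Isb i = pc i * lamOpt)
    (hulb : ∀ i, ulb i = 1 - lamOpt * pu i / Il i) :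
    (∑ i, Isb i = ∑ i, Il i * ulb i) ∧
    (∀ Is ul : Fin n → ℝ, (∑ i, Is i = ∑ i, Il i * ul i) →
      ((∑ i, (Is i) ^ 2 / (2 * pc i) + ∑ i, (Il i) ^ 2 * (1 - ul i) ^ 2 / (2 * pu i)
          ≥ ∑ i, (Isb i) ^ 2 / (2 * pc i) + ∑ i, (Il i) ^ 2 * (1 - ulb i) ^ 2 / (2 * pu i)) ∧
        ((∑ i, (Is i) ^ 2 / (2 * pc i) + ∑ i, (Il i) ^ 2 * (1 - ul i) ^ 2 / (2 * pu i)
            = ∑ i, (Isb i) ^ 2 / (2 * pc i) + ∑ i, (Il i) ^ 2 * (1 - ulb i) ^ 2 / (2 * pu i))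
          ↔ (Is = Isb ∧ ul = ulb)))) := by
  have hne : Nonempty (Fin n) := ⟨⟨0, hn⟩⟩
  have hpos : 0 < ∑ i, (pc i + pu i) :=
    Finset.sum_pos (fun i _ => add_pos (hpc i) (hpu i)) Finset.univ_nonempty
  have hbal : ∑ i, Isb i = ∑ i, Il i * ulb i := by
    have hload : ∀ i, Il i * ulb i = Il i - pu i * lamOpt := fun i => by
      have := (hIl i).ne'
      rw [hulb]
      field_simp
    have hsum : lamOpt * ∑ i, (pc i + pu i) = ∑ i, Il i := by
      rw [hlam, div_mul_cancel₀ _ hpos.ne']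
    simp only [hIsb, hload, Finset.sum_sub_distrib, ← Finset.sum_mul]
    rw [Finset.sum_add_distrib] at hsum
    linarith
  refine ⟨hbal, fun Is ul h => ?_⟩
  have hwc : ∀ i, 0 < (2 * pc i)⁻¹ := fun i => by have := hpc i; positivity
  have hwu : ∀ i, 0 < Il i ^ 2 / (2 * pu i) := fun i => by
    have := hpu i
    have := hIl i
    positivity
  set A := ∑ i, (2 * pc i)⁻¹ * (Is i - Isb i) ^ 2 with hA
  set B := ∑ i, Il i ^ 2 / (2 * pu i) * (ul i - ulb i) ^ 2 with hB
  have hA0 : 0 ≤ A := Finset.sum_nonneg fun i _ => mul_nonneg (hwc i).le (sq_nonneg _)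
  have hB0 : 0 ≤ B := Finset.sum_nonneg fun i _ => mul_nonneg (hwu i).le (sq_nonneg _)
  have hcost : ∑ i, Is i ^ 2 / (2 * pc i) =
      ∑ i, Isb i ^ 2 / (2 * pc i) + A + lamOpt * (∑ i, Is i - ∑ i, Isb i) := by
    rw [hA, ← Finset.sum_sub_distrib, Finset.mul_sum, ← Finset.sum_add_distrib,
      ← Finset.sum_add_distrib]
    refine Finset.sum_congr rfl fun i _ => ?_
    rw [sq_div_two_mul_eq_add (hpc i) (hIsb i), div_eq_inv_mul ((Is i - Isb i) ^ 2)]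
  have hutil : ∑ i, Il i ^ 2 * (1 - ul i) ^ 2 / (2 * pu i) =
      ∑ i, Il i ^ 2 * (1 - ulb i) ^ 2 / (2 * pu i) + B -
        lamOpt * (∑ i, Il i * ul i - ∑ i, Il i * ulb i) := by
    rw [hB, ← Finset.sum_sub_distrib, Finset.mul_sum, ← Finset.sum_add_distrib,
      ← Finset.sum_sub_distrib]
    refine Finset.sum_congr rfl fun i _ => ?_
    rw [sq_mul_one_sub_sq_div_eq_add (hpu i) (hIl i) (hulb i),
      mul_div_right_comm _ ((ul i - ulb i) ^ 2)]
  rw [← sum_weighted_sq_sub_eq_zero_iff hwc, ← sum_weighted_sq_sub_eq_zero_iff hwu, ← hA, ← hB,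
    hcost, hutil, h, hbal]
  refine ⟨by linarith, fun heq => ⟨by linarith, by linarith⟩, fun ⟨h1, h2⟩ => by linarith⟩
end

section
/- (KKT conditions characterize the optimum of Objective 1.) Let n, m be positive integers; let α, β, γ > 0; let R_s, I_l ∈ ℝ^{n×n} and R ∈ ℝ^{m×m} be diagonal matrices with strictly positive diagonal entries; let Π_c, Π_u ∈ ℝ^{n×n} be diagonal with strictly positive diagonal entries; let B ∈ ℝ^{n×m}, 𝓛 := B R⁻¹ Bᵀ, and V_d ∈ ℝⁿ. Define F(u_s, u_l, I_s, V) = α( ½ I_sᵀ Π_c⁻¹ I_s + ½ (𝟙 − u_l)ᵀ I_l Π_u⁻¹ I_l (𝟙 − u_l) ) + (β/2)‖u_s‖² + (γ/2)‖V − V_d‖². Suppose (ū_s, ū_l, Ī_s, V̄, λ̄_a, λ̄_b) ∈ (ℝⁿ)⁶ satisfies the KKT conditions: β ū_s + λ̄_a = 0; −α I_l Π_u⁻¹ I_l (𝟙 − ū_l) − I_l λ̄_b = 0; α Π_c⁻¹ Ī_s − R_s λ̄_a + λ̄_b = 0; γ(V̄ − V_d) − λ̄_a − 𝓛 λ̄_b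 = 0; ū_s − R_s Ī_s − V̄ = 0; −I_l ū_l + Ī_s − 𝓛 V̄ = 0. Then for every (u_s, u_l, I_s, V) ∈ (ℝⁿ)⁴ satisfying the equality constraints u_s − R_s I_s − V = 0 and −I_l u_l + I_s − 𝓛 V = 0, one has F(u_s, u_l, I_s, V) ≥ F(ū_s, ū_l, Ī_s, V̄), with equality if and only if (u_s, u_l, I_s, V) = (ū_s, ū_l, Ī_s, V̄). In particular, the constrained minimizer of F is unique and equals (ū_s, ū_l, Ī_s, V̄). -/
open Matrix

theorem Matrix.inv_diagonal_of_pos {ι : Type*} [Fintype ι] [DecidableEq ι] {d : ι → ℝ}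
    (hd : ∀ i, 0 < d i) : (Matrix.diagonal d)⁻¹ = Matrix.diagonal (fun i => (d i)⁻¹) := by
  apply Matrix.inv_eq_right_inv
  rw [Matrix.diagonal_mul_diagonal, ← Matrix.diagonal_one]
  congr 1
  funext i
  exact mul_inv_cancel₀ (hd i).ne'

/-- KKT conditions characterize the optimum of Objective 1: a point satisfying the
first-order (KKT) conditions of the strictly convex psycho-social-physical welfare
problem is its unique constrained minimizer. -/
theorem stmt_8 (n m : ℕ) (hn : 0 < n) (hm : 0 < m)
    (α β γ : ℝ) (hα : 0 < α) (hβ : 0 < β) (hγ : 0 < γ)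
    (rs il pc pu : Fin n → ℝ)
    (hrs : ∀ i, 0 < rs i) (hil : ∀ i, 0 < il i)
    (hpc : ∀ i, 0 < pc i) (hpu : ∀ i, 0 < pu i)
    (r : Fin m → ℝ) (hr : ∀ k, 0 < r k)
    (B : Matrix (Fin n) (Fin m) ℝ)
    (Vd : Fin n → ℝ)
    (Rs Il Pc Pu 𝓛 : Matrix (Fin n) (Fin n) ℝ)
    (hRs : Rs = Matrix.diagonal rs) (hIl : Il = Matrix.diagonal il)
    (hPc : Pc = Matrix.diagonal pc) (hPu : Pu = Matrix.diagonal pu)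
    (h𝓛 : 𝓛 = B * (Matrix.diagonal r)⁻¹ * Bᵀ)
    (F : (Fin n → ℝ) → (Fin n → ℝ) → (Fin n → ℝ) → (Fin n → ℝ) → ℝ)
    (hF : F = fun us ul Is V =>
      α * ((1 / 2) * (Is ⬝ᵥ Pc⁻¹.mulVec Is)
            + (1 / 2) * ((1 - ul) ⬝ᵥ (Il * Pu⁻¹ * Il).mulVec (1 - ul)))
        + β / 2 * ∑ i, (us i) ^ 2
        + γ / 2 * ∑ i, (V i - Vd i) ^ 2)
    (usb ulb Isb Vb lamA lamB : Fin n → ℝ)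
    -- KKT conditions (24)
    (hkkt1 : β • usb + lamA = 0)
    (hkkt2 : -(α • (Il * Pu⁻¹ * Il).mulVec (1 - ulb)) - Il.mulVec lamB = 0)
    (hkkt3 : α • Pc⁻¹.mulVec Isb - Rs.mulVec lamA + lamB = 0)
    (hkkt4 : γ • (Vb - Vd) - lamA - 𝓛.mulVec lamB = 0)
    (hkkt5 : usb - Rs.mulVec Isb - Vb = 0)
    (hkkt6 : -(Il.mulVec ulb) + Isb - 𝓛.mulVec Vb = 0) :
    ∀ us ul Is V : Fin n → ℝ,
      us - Rs.mulVec Is - V = 0 →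
      -(Il.mulVec ul) + Is - 𝓛.mulVec V = 0 →
      F us ul Is V ≥ F usb ulb Isb Vb ∧
        (F us ul Is V = F usb ulb Isb Vb ↔
          (us = usb ∧ ul = ulb ∧ Is = Isb ∧ V = Vb)) := by
  intro us ul Is V hc1 hc2
  have hsymm : 𝓛ᵀ = 𝓛 := by
    rw [h𝓛, Matrix.inv_diagonal_of_pos hr]
    simp [Matrix.transpose_mul, Matrix.mul_assoc]
  have hadj : (V - Vb) ⬝ᵥ 𝓛 *ᵥ lamB = lamB ⬝ᵥ 𝓛 *ᵥ (V - Vb) := by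
    conv_lhs => rw [Matrix.dotProduct_mulVec, ← Matrix.mulVec_transpose, hsymm,
      dotProduct_comm]
  subst hRs hIl hPc hPu
  rw [Matrix.inv_diagonal_of_pos hpu, Matrix.diagonal_mul_diagonal,
    Matrix.diagonal_mul_diagonal] at hF hkkt2
  rw [Matrix.inv_diagonal_of_pos hpc] at hF hkkt3
  have hgap : F us ul Is V - F usb ulb Isb Vb =
      ∑ i, (α / 2 * (pc i)⁻¹ * (Is i - Isb i) ^ 2
        + α / 2 * (il i * (pu i)⁻¹ * il i) * (ul i - ulb i) ^ 2
        + β / 2 * (us i - usb i) ^ 2 + γ / 2 * (V i - Vb i) ^ 2) := by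
    have hzero : ∑ i, ((V i - Vb i) * (𝓛 *ᵥ lamB) i
        - lamB i * ((𝓛 *ᵥ V) i - (𝓛 *ᵥ Vb) i)) = 0 := by
      rw [Finset.sum_sub_distrib, sub_eq_zero]
      simpa [dotProduct, Matrix.mulVec_sub] using hadj
    rw [← add_zero (∑ i, _), ← hzero, hF]
    simp only [dotProduct, Matrix.mulVec_diagonal, Finset.mul_sum, ← Finset.sum_add_distrib,
      ← Finset.sum_sub_distrib]
    refine Finset.sum_congr rfl fun i _ => ?_
    have h1 := congrFun hkkt1 i
    have h2 := congrFun hkkt2 i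
    have h3 := congrFun hkkt3 i
    have h4 := congrFun hkkt4 i
    have h5 := congrFun hkkt5 i
    have h6 := congrFun hkkt6 i
    have h7 := congrFun hc1 i
    have h8 := congrFun hc2 i
    simp only [Pi.add_apply, Pi.sub_apply, Pi.neg_apply, Pi.smul_apply, Pi.zero_apply,
      Pi.one_apply, smul_eq_mul, Matrix.mulVec_diagonal] at h1 h2 h3 h4 h5 h6 h7 h8 ⊢
    linear_combination (us i - usb i) * h1 + (ul i - ulb i) * h2 + (Is i - Isb i) * h3
      + (V i - Vb i) * h4 - lamA i * (h7 - h5) - lamB i * (h8 - h6)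
  have hIs : ∀ i, 0 < α / 2 * (pc i)⁻¹ := fun i => by have := hpc i; positivity
  have hul : ∀ i, 0 < α / 2 * (il i * (pu i)⁻¹ * il i) := fun i => by
    have := hpu i
    have := hil i
    positivity
  have hnonneg : ∀ i ∈ Finset.univ, 0 ≤ α / 2 * (pc i)⁻¹ * (Is i - Isb i) ^ 2
        + α / 2 * (il i * (pu i)⁻¹ * il i) * (ul i - ulb i) ^ 2
        + β / 2 * (us i - usb i) ^ 2 + γ / 2 * (V i - Vb i) ^ 2 := fun i _ => by
    have := hIs i
    have := hul i
    positivity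
  refine ⟨by linarith [Finset.sum_nonneg hnonneg], fun h => ?_, ?_⟩
  · rw [h, sub_self, eq_comm, Finset.sum_eq_zero_iff_of_nonneg hnonneg] at hgap
    have hterms : ∀ i, us i = usb i ∧ ul i = ulb i ∧ Is i = Isb i ∧ V i = Vb i := fun i => by
      have h0 := hgap i (Finset.mem_univ i)
      have a1 := mul_nonneg (hIs i).le (sq_nonneg (Is i - Isb i))
      have a2 := mul_nonneg (hul i).le (sq_nonneg (ul i - ulb i))
      have a3 := mul_nonneg (half_pos hβ).le (sq_nonneg (us i - usb i))
      have a4 := mul_nonneg (half_pos hγ).le (sq_nonneg (V i - Vb i))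
      have key : ∀ {c x y : ℝ}, 0 < c → c * (x - y) ^ 2 = 0 → x = y := fun hc h =>
        sub_eq_zero.1 (pow_eq_zero_iff two_ne_zero |>.1 ((mul_eq_zero.1 h).resolve_left hc.ne'))
      exact ⟨key (half_pos hβ) (by linarith), key (hul i) (by linarith),
        key (hIs i) (by linarith), key (half_pos hγ) (by linarith)⟩
    exact ⟨funext fun i => (hterms i).1, funext fun i => (hterms i).2.1,
      funext fun i => (hterms i).2.2.1, funext fun i => (hterms i).2.2.2⟩
  · rintro ⟨rfl, rfl, rfl, rfl⟩
    rfl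
end

section
/- (Passivity property of the primal-dual controller, Proposition 2(a).) Let n, m be positive integers; let α, β, γ, τ_s, τ_l, τ_I, τ_V, τ_a, τ_b be strictly positive reals; let R_s, I_l, Π_c, Π_u ∈ ℝ^{n×n} be diagonal with strictly positive diagonal entries; let R ∈ ℝ^{m×m} be diagonal with strictly positive diagonal entries, B ∈ ℝ^{n×m}, 𝓛 := B R⁻¹ Bᵀ, and V_d ∈ ℝⁿ. Suppose u_s*, u_l*, I_s*, V*, λ_a, λ_b, ν_s, ν_l : ℝ → ℝⁿ are differentiable functions satisfying, for all t, the controller dynamics −τ_s u̇_s* = β u_s* + λ_a − ν_s; −τ_l u̇_l* = −α I_l Π_u⁻¹ I_l (𝟙 − u_l*) − I_l λ_b − ν_l; −τ_I İ_s* = α Π_c⁻¹ I_s* − R_s λ_a + λ_b; −τ_V V̇* = γ(V* − V_d) − λ_a − 𝓛 λ_b; τ_a λ̇_a = u_s* − R_s I_s* − V*; τ_b λ̇_b = −I_l u_l* + I_s* − 𝓛 V*, and suppose ν_s, ν_l are differentiable with derivatives ν_{sd}, ν_{ld}. Define S_c(t) := ½( τ_s‖u̇_s*(t)‖² + τ_l‖u̇_l*(t)‖²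 + τ_I‖İ_s*(t)‖² + τ_V‖V̇*(t)‖² + τ_a‖λ̇_a(t)‖² + τ_b‖λ̇_b(t)‖² ). Then S_c is differentiable and, for all t, S_c'(t) = −β‖u̇_s*(t)‖² − α u̇_l*(t)ᵀ I_l Π_u⁻¹ I_l u̇_l*(t) − α İ_s*(t)ᵀ Π_c⁻¹ İ_s*(t) − γ‖V̇*(t)‖² + ν_{sd}(t)ᵀ u̇_s*(t) + ν_{ld}(t)ᵀ u̇_l*(t); in particular S_c'(t) ≤ ν_{sd}(t)ᵀ u̇_s*(t) + ν_{ld}(t)ᵀ u̇_l*(t). -/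
open Matrix

theorem HasDerivAt.matrix_mulVec {m n : Type*} [Fintype m] [Fintype n]
    (A : Matrix m n ℝ) {f : ℝ → n → ℝ} {f' : n → ℝ} {t : ℝ} (hf : HasDerivAt f f' t) :
    HasDerivAt (fun s => A *ᵥ f s) (A *ᵥ f') t :=
  A.mulVecLin.toContinuousLinearMap.hasFDerivAt.comp_hasDerivAt t hf

theorem HasDerivAt.dotProduct_self {n : Type*} [Fintype n]
    {f : ℝ → n → ℝ} {f' : n → ℝ} {t : ℝ} (hf : HasDerivAt f f' t) :
    HasDerivAt (fun s => f s ⬝ᵥ f s) (2 * (f t ⬝ᵥ f')) t := by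
  have h := HasDerivAt.fun_sum (u := Finset.univ) fun i _ =>
    (hasDerivAt_pi.1 hf i).mul (hasDerivAt_pi.1 hf i)
  refine h.congr_deriv ?_
  simp only [dotProduct, Finset.mul_sum]
  exact Finset.sum_congr rfl fun i _ => by ring

/-- If `c • g = F` with `c ≠ 0`, the weighted energy `c ‖g‖²` has derivative `2 ⟨g, F'⟩`. -/
theorem hasDerivAt_mul_dotProduct_self_of_smul_eq {n : Type*} [Fintype n]
    {c : ℝ} (hc : c ≠ 0) {g F : ℝ → n → ℝ} {F' : n → ℝ} {t : ℝ}
    (h : ∀ s, c • g s = F s) (hF : HasDerivAt F F' t) :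
    HasDerivAt (fun s => c * (g s ⬝ᵥ g s)) (2 * (g t ⬝ᵥ F')) t := by
  have hg : g = fun s => c⁻¹ • F s := by
    funext s
    rw [← h s, inv_smul_smul₀ hc]
  have hg' : HasDerivAt g (c⁻¹ • F') t := by
    rw [hg]
    exact hF.const_smul c⁻¹
  refine (hg'.dotProduct_self.const_mul c).congr_deriv ?_
  rw [dotProduct_smul, smul_eq_mul]
  field_simp

theorem Matrix.IsSymm.dotProduct_mulVec_comm {n : Type*} [Fintype n] {A : Matrix n n ℝ}
    (hA : A.IsSymm) (x y : n → ℝ) : x ⬝ᵥ A *ᵥ y = y ⬝ᵥ A *ᵥ x := by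
  rw [dotProduct_mulVec, ← mulVec_transpose, hA.eq, dotProduct_comm]

theorem Matrix.posSemidef_inv_diagonal {n : Type*} [Fintype n] [DecidableEq n] {d : n → ℝ}
    (hd : ∀ i, 0 < d i) : (diagonal d)⁻¹.PosSemidef :=
  (PosSemidef.diagonal fun i => (hd i).le).inv

/-- Passivity property of the primal-dual controller (Proposition 2(a)): along solutions
of the controller dynamics, the storage function `S_c = ½ ẋ_cᵀ τ ẋ_c` satisfies
`S_c' = −β‖u̇_s*‖² − α u̇_l*ᵀ I_l Π_u⁻¹ I_l u̇_l* − α İ_s*ᵀ Π_c⁻¹ İ_s* − γ‖V̇*‖²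
 + ν_{sd}ᵀ u̇_s* + ν_{ld}ᵀ u̇_l* ≤ ν_{sd}ᵀ u̇_s* + ν_{ld}ᵀ u̇_l*`. -/
theorem stmt_9 (n m : ℕ) (hn : 0 < n) (hm : 0 < m)
    (α β γ τs τl τI τV τa τb : ℝ)
    (hα : 0 < α) (hβ : 0 < β) (hγ : 0 < γ)
    (hτs : 0 < τs) (hτl : 0 < τl) (hτI : 0 < τI) (hτV : 0 < τV) (hτa : 0 < τa) (hτb : 0 < τb)
    (rs il pc pu : Fin n → ℝ)
    (hrs : ∀ i, 0 < rs i) (hil : ∀ i, 0 < il i) (hpc : ∀ i, 0 < pc i) (hpu : ∀ i, 0 < pu i)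
    (r : Fin m → ℝ) (hr : ∀ k, 0 < r k)
    (B : Matrix (Fin n) (Fin m) ℝ)
    (Vd : Fin n → ℝ)
    (Rs Il Pc Pu 𝓛 : Matrix (Fin n) (Fin n) ℝ)
    (hRs : Rs = Matrix.diagonal rs) (hIl : Il = Matrix.diagonal il)
    (hPc : Pc = Matrix.diagonal pc) (hPu : Pu = Matrix.diagonal pu)
    (h𝓛 : 𝓛 = B * (Matrix.diagonal r)⁻¹ * Bᵀ)
    (us ul Is V la lb nus nul us' ul' Is' V' la' lb' nusd nuld : ℝ → Fin n → ℝ)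
    (hus : ∀ t, HasDerivAt us (us' t) t)
    (hul : ∀ t, HasDerivAt ul (ul' t) t)
    (hIs : ∀ t, HasDerivAt Is (Is' t) t)
    (hV : ∀ t, HasDerivAt V (V' t) t)
    (hla : ∀ t, HasDerivAt la (la' t) t)
    (hlb : ∀ t, HasDerivAt lb (lb' t) t)
    (hnus : ∀ t, HasDerivAt nus (nusd t) t)
    (hnul : ∀ t, HasDerivAt nul (nuld t) t)
    -- controller dynamics (25)
    (hdyn1 : ∀ t, -(τs • us' t) = β • us t + la t - nus t)
    (hdyn2 : ∀ t, -(τl • ul' t) =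
      -(α • (Il * Pu⁻¹ * Il).mulVec (1 - ul t)) - Il.mulVec (lb t) - nul t)
    (hdyn3 : ∀ t, -(τI • Is' t) = α • Pc⁻¹.mulVec (Is t) - Rs.mulVec (la t) + lb t)
    (hdyn4 : ∀ t, -(τV • V' t) = γ • (V t - Vd) - la t - 𝓛.mulVec (lb t))
    (hdyn5 : ∀ t, τa • la' t = us t - Rs.mulVec (Is t) - V t)
    (hdyn6 : ∀ t, τb • lb' t = -(Il.mulVec (ul t)) + Is t - 𝓛.mulVec (V t))
    (Sc : ℝ → ℝ)
    (hSc : Sc = fun t => (1 / 2) * (τs * (us' t ⬝ᵥ us' t) + τl * (ul' t ⬝ᵥ ul' t)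
      + τI * (Is' t ⬝ᵥ Is' t) + τV * (V' t ⬝ᵥ V' t)
      + τa * (la' t ⬝ᵥ la' t) + τb * (lb' t ⬝ᵥ lb' t))) :
    ∀ t, HasDerivAt Sc
        (-(β * (us' t ⬝ᵥ us' t)) - α * (ul' t ⬝ᵥ (Il * Pu⁻¹ * Il).mulVec (ul' t))
          - α * (Is' t ⬝ᵥ Pc⁻¹.mulVec (Is' t)) - γ * (V' t ⬝ᵥ V' t)
          + nusd t ⬝ᵥ us' t + nuld t ⬝ᵥ ul' t) t
      ∧ (-(β * (us' t ⬝ᵥ us' t)) - α * (ul' t ⬝ᵥ (Il * Pu⁻¹ * Il).mulVec (ul' t))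
          - α * (Is' t ⬝ᵥ Pc⁻¹.mulVec (Is' t)) - γ * (V' t ⬝ᵥ V' t)
          + nusd t ⬝ᵥ us' t + nuld t ⬝ᵥ ul' t)
        ≤ nusd t ⬝ᵥ us' t + nuld t ⬝ᵥ ul' t := by
  have hRsS : Rs.IsSymm := hRs ▸ isSymm_diagonal rs
  have hIlS : Il.IsSymm := hIl ▸ isSymm_diagonal il
  have hLS : 𝓛.IsSymm := by
    rw [h𝓛, IsSymm, transpose_mul, transpose_mul, transpose_transpose, transpose_nonsing_inv,
      diagonal_transpose, Matrix.mul_assoc]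
  have hPcP : Pc⁻¹.PosSemidef := hPc ▸ posSemidef_inv_diagonal hpc
  have hKP : (Il * Pu⁻¹ * Il).PosSemidef := by
    have h := (hPu ▸ posSemidef_inv_diagonal hpu : Pu⁻¹.PosSemidef).conjTranspose_mul_mul_same Il
    rwa [conjTranspose_eq_transpose_of_trivial, hIlS.eq] at h
  intro t
  constructor
  · have d1 := hasDerivAt_mul_dotProduct_self_of_smul_eq hτs.ne'
      (fun s => neg_eq_iff_eq_neg.1 (hdyn1 s))
      ((((hus t).const_smul β).add (hla t)).sub (hnus t)).neg
    have d2 := hasDerivAt_mul_dotProduct_self_of_smul_eq hτl.ne'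
      (fun s => neg_eq_iff_eq_neg.1 (hdyn2 s))
      ((((((hul t).const_sub 1).matrix_mulVec (Il * Pu⁻¹ * Il)).const_smul α).neg.sub
        ((hlb t).matrix_mulVec Il)).sub (hnul t)).neg
    have d3 := hasDerivAt_mul_dotProduct_self_of_smul_eq hτI.ne'
      (fun s => neg_eq_iff_eq_neg.1 (hdyn3 s))
      (((((hIs t).matrix_mulVec Pc⁻¹).const_smul α).sub
        ((hla t).matrix_mulVec Rs)).add (hlb t)).neg
    have d4 := hasDerivAt_mul_dotProduct_self_of_smul_eq hτV.ne'
      (fun s => neg_eq_iff_eq_neg.1 (hdyn4 s))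
      (((((hV t).sub_const Vd).const_smul γ).sub (hla t)).sub
        ((hlb t).matrix_mulVec 𝓛)).neg
    have d5 := hasDerivAt_mul_dotProduct_self_of_smul_eq hτa.ne' hdyn5
      (((hus t).sub ((hIs t).matrix_mulVec Rs)).sub (hV t))
    have d6 := hasDerivAt_mul_dotProduct_self_of_smul_eq hτb.ne' hdyn6
      ((((hul t).matrix_mulVec Il).neg.add (hIs t)).sub ((hV t).matrix_mulVec 𝓛))
    rw [hSc]
    refine ((((((d1.add d2).add d3).add d4).add d5).add d6).const_mul (1 / 2)).congr_deriv ?_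
    simp only [dotProduct_neg, dotProduct_add, dotProduct_sub, dotProduct_smul, mulVec_neg,
      smul_neg, smul_eq_mul]
    rw [hRsS.dotProduct_mulVec_comm (la' t), hIlS.dotProduct_mulVec_comm (lb' t),
      hLS.dotProduct_mulVec_comm (lb' t), dotProduct_comm (la' t) (us' t),
      dotProduct_comm (la' t) (V' t), dotProduct_comm (lb' t) (Is' t),
      dotProduct_comm (nusd t), dotProduct_comm (nuld t)]
    ring
  · have h1 : 0 ≤ us' t ⬝ᵥ us' t := dotProduct_self_star_nonneg (us' t)
    have h2 : 0 ≤ V' t ⬝ᵥ V' t := dotProduct_self_star_nonneg (V' t)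
    have h3 : 0 ≤ ul' t ⬝ᵥ (Il * Pu⁻¹ * Il) *ᵥ ul' t := hKP.dotProduct_mulVec_nonneg (ul' t)
    have h4 : 0 ≤ Is' t ⬝ᵥ Pc⁻¹ *ᵥ Is' t := hPcP.dotProduct_mulVec_nonneg (Is' t)
    linarith [mul_nonneg hβ.le h1, mul_nonneg hγ.le h2, mul_nonneg hα.le h3,
      mul_nonneg hα.le h4]
end

section
/- (Physical steady state coincides with optimizer, end of proof of Proposition 3.) Let n, m be positive integers; let R_s, I_l ∈ ℝ^{n×n} and R ∈ ℝ^{m×m} be diagonal matrices with strictly positive diagonal entries, B ∈ ℝ^{n×m}, and 𝓛 := B R⁻¹ Bᵀ. Suppose ū_s*, ū_l*, Ī_s, V̄ ∈ ℝⁿ, Ī ∈ ℝᵐ, and Ī_s*, V̄* ∈ ℝⁿ satisfy: (i) the plant steady-state equations V̄ = −R_s Ī_s + ū_s*, Ī = −R⁻¹ Bᵀ V̄, Ī_s = −B Ī + I_l ū_l*; and (ii) the controller multiplier steady-state equations ū_s* − R_s Ī_s* − V̄* = 0 and −I_l ū_l* + Ī_s* − 𝓛 V̄* = 0. Then Ī_s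 = Ī_s*, V̄ = V̄*, and Ī = −R⁻¹ Bᵀ V̄*. -/
open Matrix

/-- If `A` is positive semidefinite and `D` is a positive diagonal matrix, then `I + A D` has
trivial kernel. -/
lemma eq_zero_of_eq_mulVec_neg_diagonal {ι : Type*} [Fintype ι] [DecidableEq ι]
    {A : Matrix ι ι ℝ} (hA : A.PosSemidef) {d : ι → ℝ} (hd : ∀ i, 0 < d i) {x : ι → ℝ}
    (hx : x = A *ᵥ (-(diagonal d *ᵥ x))) : x = 0 := by
  have hnonneg := hA.dotProduct_mulVec_nonneg (-(diagonal d *ᵥ x))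
  rw [← hx] at hnonneg
  simp only [star_trivial, dotProduct, Pi.neg_apply, mulVec_diagonal, neg_mul,
    Finset.sum_neg_distrib, Left.nonneg_neg_iff] at hnonneg
  have hterm : ∀ i ∈ Finset.univ, 0 ≤ d i * x i * x i := fun i _ => by
    rw [mul_assoc]
    exact mul_nonneg (hd i).le (mul_self_nonneg _)
  have hsum := le_antisymm hnonneg (Finset.sum_nonneg hterm)
  ext i
  have hi := (Finset.sum_eq_zero_iff_of_nonneg hterm).1 hsum i (Finset.mem_univ i)
  simpa [(hd i).ne'] using hi

/-- Physical steady state coincides with the optimizer (end of proof of Proposition 3):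
if the plant steady-state equations hold with input `(ū_s*, ū_l*)` and the controller
optimization variables `(Ī_s*, V̄*)` satisfy the reduced steady-state equations with the
same input, then `Ī_s = Ī_s*`, `V̄ = V̄*` and `Ī = −R⁻¹ Bᵀ V̄*`. -/
theorem stmt_13 (n m : ℕ) (hn : 0 < n) (hm : 0 < m)
    (rs il : Fin n → ℝ) (hrs : ∀ i, 0 < rs i) (hil : ∀ i, 0 < il i)
    (r : Fin m → ℝ) (hr : ∀ k, 0 < r k)
    (B : Matrix (Fin n) (Fin m) ℝ)
    (uss uls Is V Iss Vs : Fin n → ℝ) (I : Fin m → ℝ)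
    -- plant steady-state equations
    (hp1 : V = -((Matrix.diagonal rs).mulVec Is) + uss)
    (hp2 : I = -(((Matrix.diagonal r)⁻¹ * Bᵀ).mulVec V))
    (hp3 : Is = -(B.mulVec I) + (Matrix.diagonal il).mulVec uls)
    -- controller multiplier steady-state equations
    (hc1 : uss - (Matrix.diagonal rs).mulVec Iss - Vs = 0)
    (hc2 : -((Matrix.diagonal il).mulVec uls) + Iss
      - (B * (Matrix.diagonal r)⁻¹ * Bᵀ).mulVec Vs = 0) :
    Is = Iss ∧ V = Vs ∧ I = -(((Matrix.diagonal r)⁻¹ * Bᵀ).mulVec Vs) := by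
  have hL : (B * (diagonal r)⁻¹ * Bᵀ).PosSemidef := by
    simpa using (PosDef.diagonal hr).inv.posSemidef.mul_mul_conjTranspose_same B
  have hV : V - Vs = -(diagonal rs *ᵥ (Is - Iss)) := by
    rw [← sub_eq_zero.1 hc1, hp1, mulVec_sub]
    abel
  have hI : Is - Iss = (B * (diagonal r)⁻¹ * Bᵀ) *ᵥ (V - Vs) := by
    have hIss : Iss = (B * (diagonal r)⁻¹ * Bᵀ) *ᵥ Vs + diagonal il *ᵥ uls := by
      rw [← sub_eq_zero.1 hc2]
      abel
    have hIs : Is = (B * (diagonal r)⁻¹ * Bᵀ) *ᵥ V + diagonal il *ᵥ uls := by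
      rw [hp3, hp2, mulVec_neg, neg_neg, mulVec_mulVec, Matrix.mul_assoc]
    rw [hIs, hIss, mulVec_sub]
    abel
  have hIs0 : Is - Iss = 0 := eq_zero_of_eq_mulVec_neg_diagonal hL hrs (hV ▸ hI)
  have hVVs : V = Vs := by
    rw [hIs0, mulVec_zero, neg_zero] at hV
    exact sub_eq_zero.1 hV
  exact ⟨sub_eq_zero.1 hIs0, hVVs, hVVs ▸ hp2⟩
end
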